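/- Let {λ_Q}_{Q∈D^β} be positive numbers indexed by a dyadic grid D^β in ℝ^d, and let σ_1,…,σ_n be weights on ℝ^d. Assume Φ_1,…,Φ_n, Ψ ∈ U and let Φ be a one-to-one correspondence from [0,∞) to [0,∞) such that Φ^{-1} = Φ_1^{-1}·…·Φ_n^{-1} and t ↦ Ψ(t)/Φ(t) is increasing on (0,∞). Define ν_σ⃗ := 1/Φ(∏_{i=1}^n Φ_i^{-1}(1/σ_i)). Suppose there exist constants C₁, C₂ > 0 such that (a) 1/ν_σ⃗(Q) ≤ C₁ Φ(∏_{i=1}^n Φ_i^{-1}(1/σ_i(Q))) for all Q ∈ D^β, and (b) ∑_{Q∈D^β} λ_Q Ψ( ∏_{i=1}^n m_{σ_i}(f_i/‖f_i‖_{L^{Φ_i}_{σ_i}}^{lux}, Q) ) ≤ C₂ for all f_i ∈ L^{Φ_i}(σ_i) with f_i ≢ 0. Then {λ_Q}_{Q∈D^β} is a (ν_σ⃗, Ψ∘Φ^{-1})-Carleson sequence, i.e. there is Λ>0 with ∑_{Q⊆R, Q∈D^β} λ_Q ≤ Λ/(Ψ∘Φ^{-1}(1/ν_σ⃗(R)))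 for every R ∈ D^β. -/

import Mathlib

open MeasureTheory Set
open scoped BigOperators ENNReal NNReal

noncomputable section

namespace TwoWeight

/-- A cube in `ℝ^d` with sides parallel to the coordinate axes and sidelength `l > 0`. -/
def IsCubeL {d : ℕ} (Q : Set (Fin d → ℝ)) (l : ℝ) : Prop :=
  0 < l ∧ ∃ c : Fin d → ℝ, Q = Set.univ.pi fun i => Set.Ico (c i) (c i + l)

/-- A nondegenerate axis-parallel cube. -/
def IsCube {d : ℕ} (Q : Set (Fin d → ℝ)) : Prop :=
  ∃ l : ℝ, IsCubeL Q l

/-- `σ(E) = ∫_E σ`. -/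
def wMeas {d : ℕ} (σ : (Fin d → ℝ) → ℝ) (E : Set (Fin d → ℝ)) : ℝ :=
  ∫ x in E, σ x

/-- A weight: a positive locally integrable function. -/
def IsWeight {d : ℕ} (σ : (Fin d → ℝ) → ℝ) : Prop :=
  (∀ x, 0 < σ x) ∧ LocallyIntegrable σ volume

/-- A doubling weight. -/
def DoublingWeight {d : ℕ} (σ : (Fin d → ℝ) → ℝ) : Prop :=
  ∃ C > 1, ∀ (Q Q' : Set (Fin d → ℝ)) (l l' : ℝ),
    IsCubeL Q l → IsCubeL Q' l' → Q ⊆ Q' → l' ≤ 2 * l →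
      wMeas σ Q' ≤ C * wMeas σ Q

/-- Growth function: a continuous nondecreasing surjection of `[0,∞)` onto itself,
not identically zero. -/
def GrowthFun (Φ : ℝ → ℝ) : Prop :=
  ContinuousOn Φ (Ici 0) ∧ MonotoneOn Φ (Ici 0) ∧ SurjOn Φ (Ici 0) (Ici 0) ∧
    ∃ t ∈ Ici (0 : ℝ), Φ t ≠ 0

/-- The `Δ'` condition. -/
def DeltaPrime (Φ : ℝ → ℝ) : Prop :=
  ∃ C > 0, ∀ s > 0, ∀ t > 0, Φ (s * t) ≤ C * Φ s * Φ t

/-- The `Δ₂` condition. -/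
def Delta2 (Φ : ℝ → ℝ) : Prop :=
  ∃ K > 0, ∀ t > 0, Φ (2 * t) ≤ K * Φ t

/-- Upper type `q`. -/
def UpperType (q : ℝ) (Φ : ℝ → ℝ) : Prop :=
  ∃ C > 0, ∀ s > 0, ∀ t ≥ (1 : ℝ), Φ (s * t) ≤ C * t ^ q * Φ s

/-- The class `𝒰^q`: growth functions of upper type `q ≥ 1` with `t ↦ Φ(t)/t`
nondecreasing on `(0,∞)`. -/
def ClassUq (q : ℝ) (Φ : ℝ → ℝ) : Prop :=
  GrowthFun Φ ∧ 1 ≤ q ∧ UpperType q Φ ∧ MonotoneOn (fun t => Φ t / t) (Ioi 0)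

/-- The class `𝒰`. -/
def ClassU (Φ : ℝ → ℝ) : Prop := ∃ q, ClassUq q Φ

/-- The class `𝒰̃^q`. -/
def ClassUtq (q : ℝ) (Φ : ℝ → ℝ) : Prop :=
  ClassUq q Φ ∧ DeltaPrime Φ ∧
    ∃ C > 0, ∀ s ≥ (1 : ℝ), ∀ t ≥ (1 : ℝ), Φ (s / t) ≤ C * Φ s / t ^ q

/-- The class `𝒰̃`. -/
def ClassUt (Φ : ℝ → ℝ) : Prop := ∃ q, ClassUtq q Φ

/-- The `∇₂` condition (for convex growth functions satisfying `Δ₂`). -/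
def Nabla2 (Φ : ℝ → ℝ) : Prop :=
  ConvexOn ℝ (Ici 0) Φ ∧ Delta2 Φ ∧
    ∃ C > 0, ∀ t > 0, (∫ s in Ioo (0 : ℝ) t, Φ s / s ^ 2) ≤ C * Φ t / t

/-- The inverse of `Φ` on `[0,∞)`. -/
def oInv (Φ : ℝ → ℝ) : ℝ → ℝ := Function.invFunOn Φ (Ici 0)

/-- Luxemburg norm of `f` in the weighted Orlicz space `L^Φ(σ)`. -/
def luxNorm {d : ℕ} (Φ : ℝ → ℝ) (σ f : (Fin d → ℝ) → ℝ) : ℝ :=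
  sInf {lam : ℝ | 0 < lam ∧
    Integrable (fun x => Φ (|f x| / lam) * σ x) volume ∧
    (∫ x, Φ (|f x| / lam) * σ x) ≤ 1}

/-- Membership in the weighted Orlicz space `L^Φ(σ)`. -/
def MemOrlicz {d : ℕ} (Φ : ℝ → ℝ) (σ f : (Fin d → ℝ) → ℝ) : Prop :=
  Measurable f ∧ ∃ lam : ℝ, 0 < lam ∧
    Integrable (fun x => Φ (|f x| / lam) * σ x) volume ∧
    (∫ x, Φ (|f x| / lam) * σ x) ≤ 1

/-- The average `m_σ(f,Q) = (1/σ(Q)) ∫_Q |f| σ`. -/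
def mAvg {d : ℕ} (σ f : (Fin d → ℝ) → ℝ) (Q : Set (Fin d → ℝ)) : ℝ :=
  (∫ x in Q, |f x| * σ x) / wMeas σ Q

/-- The weighted multilinear Hardy–Littlewood maximal function `M_σ⃗`. -/
def multiMaxW {d n : ℕ} (σ f : Fin n → (Fin d → ℝ) → ℝ) (x : Fin d → ℝ) : ℝ :=
  ⨆ Q : {Q : Set (Fin d → ℝ) // IsCube Q ∧ x ∈ Q}, ∏ i, mAvg (σ i) (f i) Q.1

/-- A dyadic grid in `ℝ^d`. -/
def IsDyadicGrid {d : ℕ} (𝒟 : Set (Set (Fin d → ℝ))) : Prop :=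
  (∀ Q ∈ 𝒟, ∃ k : ℤ, IsCubeL Q ((2 : ℝ) ^ k)) ∧
  (∀ Q ∈ 𝒟, ∀ Q' ∈ 𝒟, Q ∩ Q' = Q ∨ Q ∩ Q' = Q' ∨ Q ∩ Q' = ∅) ∧
  (∀ k : ℤ, ∀ x : Fin d → ℝ, ∃ Q ∈ 𝒟, IsCubeL Q ((2 : ℝ) ^ k) ∧ x ∈ Q)

/-- The dyadic weighted multilinear maximal function `M_σ⃗^{D^β}`. -/
def multiMaxWD {d n : ℕ} (𝒟 : Set (Set (Fin d → ℝ)))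
    (σ f : Fin n → (Fin d → ℝ) → ℝ) (x : Fin d → ℝ) : ℝ :=
  ⨆ Q : {Q : Set (Fin d → ℝ) // Q ∈ 𝒟 ∧ x ∈ Q}, ∏ i, mAvg (σ i) (f i) Q.1

/-- The multilinear fractional maximal function `M_α`. -/
def fracMax {d n : ℕ} (α : ℝ) (f : Fin n → (Fin d → ℝ) → ℝ) (x : Fin d → ℝ) : ℝ :=
  ⨆ Q : {Q : Set (Fin d → ℝ) // IsCube Q ∧ x ∈ Q},
    (volume Q.1).toReal ^ (α / d) *
      ∏ i, (∫ y in Q.1, |f i y|) / (volume Q.1).toReal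

/-- The Hardy–Littlewood maximal function. -/
def hlMax {d : ℕ} (f : (Fin d → ℝ) → ℝ) (x : Fin d → ℝ) : ℝ :=
  ⨆ Q : {Q : Set (Fin d → ℝ) // IsCube Q ∧ x ∈ Q},
    (∫ y in Q.1, |f y|) / (volume Q.1).toReal

/-- The Fujii–Wilson `A_∞` characteristic. -/
def ainftyConst {d : ℕ} (σ : (Fin d → ℝ) → ℝ) : ℝ :=
  sSup {r : ℝ | ∃ Q : Set (Fin d → ℝ), IsCube Q ∧
    r = (∫ x in Q, hlMax (Q.indicator σ) x) / wMeas σ Q}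

/-- Membership in the Fujii–Wilson class `A_∞`. -/
def MemAinfty {d : ℕ} (σ : (Fin d → ℝ) → ℝ) : Prop :=
  BddAbove {r : ℝ | ∃ Q : Set (Fin d → ℝ), IsCube Q ∧
    r = (∫ x in Q, hlMax (Q.indicator σ) x) / wMeas σ Q}

/-- The complementary (conjugate) function of `Φ`. -/
def complFun (Φ : ℝ → ℝ) (s : ℝ) : ℝ :=
  ⨆ t : Ici (0 : ℝ), (s * t.1 - Φ t.1)

end TwoWeight
namespace TwoWeight

namespace ClassU

variable {Φ : ℝ → ℝ}

lemma pos (h : ClassU Φ) {s : ℝ} (hs : 0 < s) : 0 < Φ s := by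
  obtain ⟨q, ⟨-, hm, hsurj, -⟩, -, ⟨C, hC, hC'⟩, -⟩ := h
  obtain ⟨u, hu, hu1⟩ := hsurj (show (1 : ℝ) ∈ Ici 0 from mem_Ici.2 zero_le_one)
  have ht : (1 : ℝ) ≤ max 1 (u / s) := le_max_left _ _
  have hle : u ≤ s * max 1 (u / s) := by
    rw [← div_le_iff₀' hs]
    exact le_max_right _ _
  have h1 : Φ u ≤ Φ (s * max 1 (u / s)) := hm hu (le_trans hu hle) hle
  have h2 := hC' s hs _ ht
  have h3 : 0 < C * max 1 (u / s) ^ q := by positivity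
  by_contra! h4
  have h5 := mul_nonpos_of_nonneg_of_nonpos h3.le h4
  linarith

lemma map_zero (h : ClassU Φ) : Φ 0 = 0 := by
  have hpos : ∀ s, 0 < s → 0 < Φ s := fun s hs => h.pos hs
  obtain ⟨q, ⟨-, -, hsurj, -⟩, -⟩ := h
  obtain ⟨u, hu, hu0⟩ := hsurj (show (0 : ℝ) ∈ Ici 0 from mem_Ici.2 le_rfl)
  rcases (show (0 : ℝ) ≤ u from hu).eq_or_lt with rfl | h'
  · exact hu0
  · exact absurd hu0 (hpos u h').ne'

lemma mul_le_map_mul (h : ClassU Φ) {C x : ℝ} (hC : 1 ≤ C) (hx : 0 ≤ x) :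
    C * Φ x ≤ Φ (C * x) := by
  rcases hx.eq_or_lt with rfl | hx
  · simp [h.map_zero]
  obtain ⟨q, -, -, -, hm⟩ := h
  have hC0 : 0 < C := by linarith
  have h1 : Φ x / x ≤ Φ (C * x) / (C * x) :=
    hm (show 0 < x from hx) (show 0 < C * x by positivity) (le_mul_of_one_le_left hx.le hC)
  rw [div_le_div_iff₀ hx (by positivity)] at h1
  have : x * (C * Φ x) ≤ x * Φ (C * x) := by linarith
  exact le_of_mul_le_mul_left this hx

lemma strictMonoOn (h : ClassU Φ) : StrictMonoOn Φ (Ici 0) := by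
  intro a ha b _ hab
  rcases (show (0 : ℝ) ≤ a from ha).eq_or_lt with rfl | h0
  · rw [h.map_zero]
    exact h.pos hab
  · have h1 : 1 < b / a := (one_lt_div h0).2 hab
    have h2 := h.mul_le_map_mul h1.le h0.le
    rw [div_mul_cancel₀ _ h0.ne'] at h2
    exact (lt_mul_of_one_lt_left (h.pos h0) h1).trans_le h2

lemma surjOn (h : ClassU Φ) : SurjOn Φ (Ici 0) (Ici 0) := by
  obtain ⟨q, ⟨-, -, hsurj, -⟩, -⟩ := h
  exact hsurj

lemma oInv_nonneg (h : ClassU Φ) {y : ℝ} (hy : 0 ≤ y) : 0 ≤ oInv Φ y :=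
  Function.invFunOn_mem (h.surjOn hy)

lemma map_oInv (h : ClassU Φ) {y : ℝ} (hy : 0 ≤ y) : Φ (oInv Φ y) = y :=
  Function.invFunOn_eq (h.surjOn hy)

lemma oInv_le (h : ClassU Φ) {x y : ℝ} (hy : 0 ≤ y) (hx : 0 ≤ x) (hxy : y ≤ Φ x) :
    oInv Φ y ≤ x := by
  rw [← h.strictMonoOn.le_iff_le (h.oInv_nonneg hy) hx, h.map_oInv hy]
  exact hxy

lemma oInv_mono (h : ClassU Φ) {x y : ℝ} (hx : 0 ≤ x) (hxy : x ≤ y) : oInv Φ x ≤ oInv Φ y :=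
  h.oInv_le hx (h.oInv_nonneg (hx.trans hxy)) (by rwa [h.map_oInv (hx.trans hxy)])

lemma oInv_pos (h : ClassU Φ) {y : ℝ} (hy : 0 < y) : 0 < oInv Φ y := by
  refine lt_of_le_of_ne (h.oInv_nonneg hy.le) fun h0 => ?_
  have := h.map_oInv hy.le
  rw [← h0, h.map_zero] at this
  exact hy.ne this

lemma oInv_mul_le (h : ClassU Φ) {C y : ℝ} (hC : 1 ≤ C) (hy : 0 ≤ y) :
    oInv Φ (C * y) ≤ C * oInv Φ y := by
  have hC0 : 0 ≤ C := by linarith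
  refine h.oInv_le (by positivity) (mul_nonneg hC0 (h.oInv_nonneg hy)) ?_
  have := h.mul_le_map_mul hC (h.oInv_nonneg hy)
  rwa [h.map_oInv hy] at this

/-- The upper type condition, with the constant depending on the dilation only. -/
lemma exists_map_mul_le (h : ClassU Φ) {t : ℝ} (ht : 1 ≤ t) :
    ∃ K > 0, ∀ s > 0, Φ (t * s) ≤ K * Φ s := by
  obtain ⟨q, -, -, ⟨C, hC, hC'⟩, -⟩ := h
  refine ⟨C * t ^ q, by positivity, fun s hs => ?_⟩
  rw [mul_comm t s]
  exact hC' s hs t ht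

end ClassU

section Cube

variable {d : ℕ} {Q : Set (Fin d → ℝ)} {l : ℝ}

lemma IsCubeL.measurableSet (h : IsCubeL Q l) : MeasurableSet Q := by
  obtain ⟨-, c, rfl⟩ := h
  exact MeasurableSet.univ_pi fun i => measurableSet_Ico

lemma IsCubeL.volume_pos (h : IsCubeL Q l) : 0 < volume Q := by
  obtain ⟨hl, c, rfl⟩ := h
  rw [volume_pi_pi]
  refine pos_iff_ne_zero.2 (Finset.prod_ne_zero_iff.2 fun i _ => ?_)
  simp [hl]

lemma IsCubeL.integrableOn (h : IsCubeL Q l) {σ : (Fin d → ℝ) → ℝ}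
    (hσ : LocallyIntegrable σ volume) : IntegrableOn σ Q volume := by
  obtain ⟨hl, c, rfl⟩ := h
  refine (hσ.integrableOn_isCompact
    (isCompact_univ_pi fun i => isCompact_Icc (a := c i) (b := c i + l))).mono_set ?_
  exact pi_mono fun i _ => Ico_subset_Icc_self

lemma IsCubeL.wMeas_pos (h : IsCubeL Q l) {σ : (Fin d → ℝ) → ℝ} (hσ : ∀ x, 0 < σ x)
    (hint : IntegrableOn σ Q volume) : 0 < wMeas σ Q := by
  rw [wMeas, integral_pos_iff_support_of_nonneg (fun x => (hσ x).le) hint]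
  have : Function.support σ = univ := by
    ext x
    simp [(hσ x).ne']
  rw [this, Measure.restrict_apply_univ]
  exact h.volume_pos

end Cube

section Indicator

variable {d : ℕ} {R : Set (Fin d → ℝ)} {Φ : ℝ → ℝ} {σ : (Fin d → ℝ) → ℝ}

lemma map_abs_indicator_div (h0 : Φ 0 = 0) (r : ℝ) :
    (fun x => Φ (|R.indicator (fun _ => (1 : ℝ)) x| / r) * σ x) =
      R.indicator fun x => Φ (1 / r) * σ x := by
  ext x
  by_cases hx : x ∈ R <;> simp [hx, h0]

/-- The infimum in the Luxemburg norm of the indicator of `R` is attained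
at `1 / Φ⁻¹(1 / σ(R))`. -/
lemma isLeast_luxNorm_indicator (h : ClassU Φ) (hR : MeasurableSet R)
    (hint : IntegrableOn σ R volume) (hpos : 0 < wMeas σ R) :
    IsLeast {r : ℝ | 0 < r ∧
      Integrable (fun x => Φ (|R.indicator (fun _ => (1 : ℝ)) x| / r) * σ x) volume ∧
      (∫ x, Φ (|R.indicator (fun _ => (1 : ℝ)) x| / r) * σ x) ≤ 1}
      (1 / oInv Φ (1 / wMeas σ R)) := by
  have hy : 0 < 1 / wMeas σ R := by positivity
  have hu := h.oInv_pos hy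
  have hI : ∀ r : ℝ, (∫ x, Φ (|R.indicator (fun _ => (1 : ℝ)) x| / r) * σ x) =
      Φ (1 / r) * wMeas σ R := by
    intro r
    rw [map_abs_indicator_div h.map_zero, integral_indicator hR, integral_const_mul, wMeas]
  refine ⟨⟨by positivity, ?_, ?_⟩, ?_⟩
  · rw [map_abs_indicator_div h.map_zero, integrable_indicator_iff hR]
    exact hint.const_mul _
  · rw [hI, one_div_one_div, h.map_oInv hy.le, one_div_mul_cancel hpos.ne']
  · rintro r ⟨hr, -, hr1⟩
    rw [hI, ← le_div_iff₀ hpos, ← h.map_oInv hy.le,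
      h.strictMonoOn.le_iff_le (show 0 ≤ 1 / r by positivity) hu.le] at hr1
    exact (one_div_le hr hu).1 hr1

lemma luxNorm_indicator (h : ClassU Φ) (hR : MeasurableSet R)
    (hint : IntegrableOn σ R volume) (hpos : 0 < wMeas σ R) :
    luxNorm Φ σ (R.indicator fun _ => (1 : ℝ)) = 1 / oInv Φ (1 / wMeas σ R) :=
  (isLeast_luxNorm_indicator h hR hint hpos).csInf_eq

lemma memOrlicz_indicator (h : ClassU Φ) (hR : MeasurableSet R)
    (hint : IntegrableOn σ R volume) (hpos : 0 < wMeas σ R) :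
    MemOrlicz Φ σ (R.indicator fun _ => (1 : ℝ)) :=
  ⟨measurable_const.indicator hR, _, (isLeast_luxNorm_indicator h hR hint hpos).1⟩

lemma mAvg_indicator_div {Q : Set (Fin d → ℝ)} (hQ : MeasurableSet Q) (hQR : Q ⊆ R)
    (hpos : 0 < wMeas σ Q) {r : ℝ} (hr : 0 < r) :
    mAvg σ (fun x => R.indicator (fun _ => (1 : ℝ)) x / r) Q = 1 / r := by
  have : (∫ x in Q, |R.indicator (fun _ => (1 : ℝ)) x / r| * σ x) = 1 / r * wMeas σ Q := by
    rw [wMeas, ← integral_const_mul]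
    refine setIntegral_congr_fun hQ fun x hx => ?_
    simp [hQR hx, abs_of_pos hr]
  rw [mAvg, this, mul_div_assoc, div_self hpos.ne', mul_one]

end Indicator

section Product

variable {n : ℕ} {Φi : Fin n → ℝ → ℝ} {Φ : ℝ → ℝ}

lemma map_oInv_of_bijOn (hΦ : BijOn Φ (Ici 0) (Ici 0)) {t : ℝ} (ht : 0 ≤ t) :
    Φ (oInv Φ t) = t :=
  Function.invFunOn_eq (hΦ.surjOn ht)

lemma oInv_map_of_bijOn (hΦ : BijOn Φ (Ici 0) (Ici 0)) {t : ℝ} (ht : 0 ≤ t) :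
    oInv Φ (Φ t) = t :=
  hΦ.injOn.leftInvOn_invFunOn ht

lemma prod_oInv_mono (hΦi : ∀ i, ClassU (Φi i)) {s t : Fin n → ℝ} (hs : ∀ i, 0 ≤ s i)
    (hst : ∀ i, s i ≤ t i) : ∏ i, oInv (Φi i) (s i) ≤ ∏ i, oInv (Φi i) (t i) :=
  Finset.prod_le_prod (fun i _ => (hΦi i).oInv_nonneg (hs i))
    fun i _ => (hΦi i).oInv_mono (hs i) (hst i)

lemma prod_oInv_pos (hΦi : ∀ i, ClassU (Φi i)) {s : Fin n → ℝ} (hs : ∀ i, 0 < s i) :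
    0 < ∏ i, oInv (Φi i) (s i) :=
  Finset.prod_pos fun i _ => (hΦi i).oInv_pos (hs i)

lemma pos_of_oInv_eq_prod (hΦ : BijOn Φ (Ici 0) (Ici 0))
    (hΦinv : ∀ t ≥ (0 : ℝ), oInv Φ t = ∏ i, oInv (Φi i) t) : 0 < n := by
  rcases Nat.eq_zero_or_pos n with rfl | h
  · have h0 : oInv Φ 0 = 1 := by simpa using hΦinv 0 le_rfl
    have h1 : oInv Φ 1 = 1 := by simpa using hΦinv 1 zero_le_one
    have h2 := map_oInv_of_bijOn hΦ (le_refl (0 : ℝ))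
    have h3 := map_oInv_of_bijOn hΦ (zero_le_one (α := ℝ))
    rw [h0] at h2
    rw [h1] at h3
    linarith
  · exact h

lemma monotoneOn_of_oInv_eq_prod (hΦi : ∀ i, ClassU (Φi i)) (hΦ : BijOn Φ (Ici 0) (Ici 0))
    (hΦinv : ∀ t ≥ (0 : ℝ), oInv Φ t = ∏ i, oInv (Φi i) t) : MonotoneOn Φ (Ici 0) := by
  intro x hx y hy hxy
  by_contra! hlt
  have hΦy : 0 ≤ Φ y := hΦ.mapsTo hy
  have h1 : oInv Φ (Φ y) ≤ oInv Φ (Φ x) := by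
    rw [hΦinv _ hΦy, hΦinv _ (hΦ.mapsTo hx)]
    exact prod_oInv_mono hΦi (fun _ => hΦy) fun _ => hlt.le
  rw [oInv_map_of_bijOn hΦ hy, oInv_map_of_bijOn hΦ hx] at h1
  rw [le_antisymm hxy h1] at hlt
  exact hlt.false

lemma oInv_le_of_le_mul_map (hΦi : ∀ i, ClassU (Φi i)) (hΦ : BijOn Φ (Ici 0) (Ici 0))
    (hΦinv : ∀ t ≥ (0 : ℝ), oInv Φ t = ∏ i, oInv (Φi i) t) {C t p : ℝ} (hC : 1 ≤ C)
    (ht : 0 ≤ t) (hp : 0 ≤ p) (htp : t ≤ C * Φ p) : oInv Φ t ≤ C ^ n * p := by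
  have hΦp : 0 ≤ Φ p := hΦ.mapsTo hp
  calc oInv Φ t = ∏ i, oInv (Φi i) t := hΦinv t ht
    _ ≤ ∏ i, oInv (Φi i) (C * Φ p) := prod_oInv_mono hΦi (fun _ => ht) fun _ => htp
    _ ≤ ∏ i, C * oInv (Φi i) (Φ p) :=
      Finset.prod_le_prod (fun i _ => (hΦi i).oInv_nonneg (ht.trans htp))
        fun i _ => (hΦi i).oInv_mul_le hC hΦp
    _ = C ^ n * p := by
      rw [Finset.prod_mul_distrib, ← hΦinv _ hΦp, oInv_map_of_bijOn hΦ hp]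
      simp

lemma one_div_sum_le_map_prod (hΦi : ∀ i, ClassU (Φi i)) (hΦ : BijOn Φ (Ici 0) (Ici 0))
    (hΦinv : ∀ t ≥ (0 : ℝ), oInv Φ t = ∏ i, oInv (Φi i) t) {s : Fin n → ℝ}
    (hs : ∀ i, 0 < s i) :
    1 / ∑ i, s i ≤ Φ (∏ i, oInv (Φi i) (1 / s i)) := by
  have hS : 0 ≤ 1 / ∑ i, s i :=
    one_div_nonneg.2 (Finset.sum_nonneg fun i _ => (hs i).le)
  have hle : ∏ i, oInv (Φi i) (1 / ∑ j, s j) ≤ ∏ i, oInv (Φi i) (1 / s i) :=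
    prod_oInv_mono hΦi (fun _ => hS) fun i =>
      one_div_le_one_div_of_le (hs i)
        (Finset.single_le_sum (fun j _ => (hs j).le) (Finset.mem_univ i))
  have hnonneg : 0 ≤ ∏ i, oInv (Φi i) (1 / ∑ j, s j) :=
    Finset.prod_nonneg fun i _ => (hΦi i).oInv_nonneg hS
  rw [← map_oInv_of_bijOn hΦ hS]
  rw [hΦinv _ hS]
  exact monotoneOn_of_oInv_eq_prod hΦi hΦ hΦinv hnonneg (hnonneg.trans hle) hle

/-- The composite weight is positive and dominated by the sum of the given weights. -/
lemma one_div_map_prod_mem_Ioc (hΦi : ∀ i, ClassU (Φi i)) (hΦ : BijOn Φ (Ici 0) (Ici 0))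
    (hΦinv : ∀ t ≥ (0 : ℝ), oInv Φ t = ∏ i, oInv (Φi i) t) {s : Fin n → ℝ}
    (hs : ∀ i, 0 < s i) :
    1 / Φ (∏ i, oInv (Φi i) (1 / s i)) ∈ Ioc 0 (∑ i, s i) := by
  have : Nonempty (Fin n) := ⟨⟨0, pos_of_oInv_eq_prod hΦ hΦinv⟩⟩
  have hS : 0 < ∑ i, s i := Finset.sum_pos (fun i _ => hs i) Finset.univ_nonempty
  have h := one_div_sum_le_map_prod hΦi hΦ hΦinv hs
  have hpos : 0 < Φ (∏ i, oInv (Φi i) (1 / s i)) := (one_div_pos.2 hS).trans_le h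
  exact ⟨one_div_pos.2 hpos, (one_div_le hS hpos).1 h⟩

lemma measurable_comp_max_of_monotoneOn {g : ℝ → ℝ} (hg : MonotoneOn g (Ici 0)) :
    Measurable fun t => g (max t 0) :=
  Monotone.measurable fun _ _ hab =>
    hg (mem_Ici.2 (le_max_right _ _)) (mem_Ici.2 (le_max_right _ _)) (max_le_max_right 0 hab)

lemma integrableOn_one_div_map_prod {d : ℕ} {R : Set (Fin d → ℝ)}
    {σ : Fin n → (Fin d → ℝ) → ℝ} (hΦi : ∀ i, ClassU (Φi i)) (hΦ : BijOn Φ (Ici 0) (Ici 0))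
    (hΦinv : ∀ t ≥ (0 : ℝ), oInv Φ t = ∏ i, oInv (Φi i) t) (hσ : ∀ i x, 0 < σ i x)
    (hint : ∀ i, IntegrableOn (σ i) R volume) :
    IntegrableOn (fun x => 1 / Φ (∏ i, oInv (Φi i) (1 / σ i x))) R volume := by
  have hmem : ∀ x, 1 / Φ (∏ i, oInv (Φi i) (1 / σ i x)) ∈ Ioc 0 (∑ i, σ i x) := fun x =>
    one_div_map_prod_mem_Ioc hΦi hΦ hΦinv fun i => hσ i x
  have hmeas : AEMeasurable (fun x => 1 / Φ (∏ i, oInv (Φi i) (1 / σ i x)))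
      (volume.restrict R) := by
    have h1 : ∀ i, AEMeasurable (fun x => oInv (Φi i) (max (1 / σ i x) 0))
        (volume.restrict R) := fun i =>
      (measurable_comp_max_of_monotoneOn
        (fun _ ha _ _ hab => (hΦi i).oInv_mono ha hab)).comp_aemeasurable
          ((hint i).aemeasurable.const_div 1)
    have h2 := (measurable_comp_max_of_monotoneOn
      (monotoneOn_of_oInv_eq_prod hΦi hΦ hΦinv)).comp_aemeasurable
        (Finset.univ.aemeasurable_fun_prod fun i _ => h1 i)
    refine (h2.const_div 1).congr (Filter.Eventually.of_forall fun x => ?_)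
    have h3 : ∀ i, max (1 / σ i x) 0 = 1 / σ i x := fun i =>
      max_eq_left (one_div_pos.2 (hσ i x)).le
    have h4 : 0 ≤ ∏ i, oInv (Φi i) (1 / σ i x) :=
      (prod_oInv_pos hΦi fun i => one_div_pos.2 (hσ i x)).le
    simp only [Function.comp_apply, h3, max_eq_left h4]
  have hsum : Integrable (fun x => ∑ i, σ i x) (volume.restrict R) :=
    integrable_finsetSum _ fun i _ => hint i
  refine Integrable.mono' hsum hmeas.aestronglyMeasurable
    (Filter.Eventually.of_forall fun x => ?_)
  rw [Real.norm_of_nonneg (hmem x).1.le]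
  exact (hmem x).2

end Product

/-- converse Carleson embedding (Proposition `pro:main16aqyh6`). -/
theorem carleson_converse {d n : ℕ}
    (𝒟 : Set (Set (Fin d → ℝ))) (h𝒟 : IsDyadicGrid 𝒟)
    (lam : Set (Fin d → ℝ) → ℝ) (hlam : ∀ Q ∈ 𝒟, 0 < lam Q)
    (σ : Fin n → (Fin d → ℝ) → ℝ) (hσ : ∀ i, IsWeight (σ i))
    (Φi : Fin n → ℝ → ℝ) (hΦi : ∀ i, ClassU (Φi i))
    (Ψ : ℝ → ℝ) (hΨ : ClassU Ψ)
    (Φ : ℝ → ℝ) (hΦ : Set.BijOn Φ (Ici 0) (Ici 0))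
    (hΦinv : ∀ t ≥ (0 : ℝ), oInv Φ t = ∏ i, oInv (Φi i) t)
    (hmono : StrictMonoOn (fun t => Ψ t / Φ t) (Ioi 0))
    (ν : (Fin d → ℝ) → ℝ)
    (hν : ν = fun x => 1 / Φ (∏ i, oInv (Φi i) (1 / σ i x)))
    (C₁ C₂ : ℝ) (hC₁ : 0 < C₁) (hC₂ : 0 < C₂)
    (hRH : ∀ Q ∈ 𝒟, 1 / wMeas ν Q ≤ C₁ * Φ (∏ i, oInv (Φi i) (1 / wMeas (σ i) Q)))
    (hEmb : ∀ f : Fin n → (Fin d → ℝ) → ℝ,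
      (∀ i, MemOrlicz (Φi i) (σ i) (f i)) →
      (∀ i, ¬ (f i =ᵐ[volume] (0 : (Fin d → ℝ) → ℝ))) →
      (∑' Q : {Q // Q ∈ 𝒟}, ENNReal.ofReal (lam Q.1 *
          Ψ (∏ i, mAvg (σ i) (fun x => f i x / luxNorm (Φi i) (σ i) (f i)) Q.1))) ≤
        ENNReal.ofReal C₂) :
    ∃ Λ > 0, ∀ R ∈ 𝒟,
      (∑' Q : {Q // Q ∈ 𝒟 ∧ Q ⊆ R}, ENNReal.ofReal (lam Q.1)) ≤
        ENNReal.ofReal (Λ / Ψ (oInv Φ (1 / wMeas ν R))) := by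
  obtain ⟨K, hK, hKΨ⟩ := hΨ.exists_map_mul_le (one_le_pow₀ (le_max_right C₁ 1) (n := n))
  refine ⟨C₂ * K, by positivity, fun R hR => ?_⟩
  have hcube : ∀ Q ∈ 𝒟, ∃ l, IsCubeL Q l := fun Q hQ => (h𝒟.1 Q hQ).imp' _ fun _ h => h
  have hQpos : ∀ Q ∈ 𝒟, ∀ i, 0 < wMeas (σ i) Q := fun Q hQ i =>
    let ⟨_, h⟩ := hcube Q hQ
    h.wMeas_pos (hσ i).1 (h.integrableOn (hσ i).2)
  obtain ⟨l, hl⟩ := hcube R hR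
  have hint : ∀ i, IntegrableOn (σ i) R volume := fun i => hl.integrableOn (hσ i).2
  have hνR : 0 < wMeas ν R := by
    rw [hν]
    exact hl.wMeas_pos
      (fun x => (one_div_map_prod_mem_Ioc hΦi hΦ hΦinv fun i => (hσ i).1 x).1)
      (integrableOn_one_div_map_prod hΦi hΦ hΦinv (fun i => (hσ i).1) hint)
  have ht : 0 < 1 / wMeas ν R := one_div_pos.2 hνR
  have hyi : ∀ i, 0 < 1 / wMeas (σ i) R := fun i => one_div_pos.2 (hQpos R hR i)
  set P : ℝ := ∏ i, oInv (Φi i) (1 / wMeas (σ i) R) with hP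
  have hPpos : 0 < P := prod_oInv_pos hΦi hyi
  have hΨP : 0 < Ψ P := hΨ.pos hPpos
  have hzpos : 0 < oInv Φ (1 / wMeas ν R) := by
    rw [hΦinv _ ht.le]
    exact prod_oInv_pos hΦi fun _ => ht
  have hz : oInv Φ (1 / wMeas ν R) ≤ max C₁ 1 ^ n * P :=
    oInv_le_of_le_mul_map hΦi hΦ hΦinv (le_max_right _ _) ht.le hPpos.le
      ((hRH R hR).trans
        (mul_le_mul_of_nonneg_right (le_max_left _ _) (hΦ.mapsTo hPpos.le)))
  have hΨz : Ψ (oInv Φ (1 / wMeas ν R)) ≤ K * Ψ P :=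
    (hΨ.strictMonoOn.monotoneOn hzpos.le (hzpos.le.trans hz) hz).trans (hKΨ P hPpos)
  have htest := hEmb (fun _ => R.indicator fun _ => (1 : ℝ))
    (fun i => memOrlicz_indicator (hΦi i) hl.measurableSet (hint i) (hQpos R hR i))
    (fun _ h => by
      rw [indicator_ae_eq_zero] at h
      simp [Function.support_const, hl.volume_pos.ne'] at h)
  have havg : ∀ Q ∈ 𝒟, Q ⊆ R → ∏ i, mAvg (σ i) (fun x => R.indicator (fun _ => (1 : ℝ)) x /
      luxNorm (Φi i) (σ i) (R.indicator fun _ => (1 : ℝ))) Q = P := by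
    intro Q hQ hQR
    obtain ⟨_, hQl⟩ := hcube Q hQ
    refine Finset.prod_congr rfl fun i _ => ?_
    rw [luxNorm_indicator (hΦi i) hl.measurableSet (hint i) (hQpos R hR i),
      mAvg_indicator_div hQl.measurableSet hQR (hQpos Q hQ i)
        (one_div_pos.2 ((hΦi i).oInv_pos (hyi i))), one_div_one_div]
  have hmul : (∑' Q : {Q // Q ∈ 𝒟 ∧ Q ⊆ R}, ENNReal.ofReal (lam Q.1)) * ENNReal.ofReal (Ψ P) ≤
      ENNReal.ofReal C₂ := by
    rw [← ENNReal.tsum_mul_right]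
    refine le_trans (le_of_eq_of_le (tsum_congr fun Q => ?_)
      (ENNReal.tsum_comp_le_tsum_of_injective
      (f := fun Q : {Q // Q ∈ 𝒟 ∧ Q ⊆ R} => (⟨Q.1, Q.2.1⟩ : {Q // Q ∈ 𝒟}))
      (fun _ _ h => Subtype.ext (congrArg (fun Q : {Q // Q ∈ 𝒟} => Q.1) h)) _)) htest
    rw [havg Q.1 Q.2.1 Q.2.2, ENNReal.ofReal_mul (hlam Q.1 Q.2.1).le]
  calc (∑' Q : {Q // Q ∈ 𝒟 ∧ Q ⊆ R}, ENNReal.ofReal (lam Q.1))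
      ≤ ENNReal.ofReal C₂ / ENNReal.ofReal (Ψ P) :=
        ENNReal.le_div_iff_mul_le (Or.inl (by simpa using hΨP)) (Or.inl ENNReal.ofReal_ne_top)
          |>.2 hmul
    _ = ENNReal.ofReal (C₂ / Ψ P) := (ENNReal.ofReal_div_of_pos hΨP).symm
    _ ≤ ENNReal.ofReal (C₂ * K / Ψ (oInv Φ (1 / wMeas ν R))) := by
        refine ENNReal.ofReal_le_ofReal ?_
        rw [div_le_div_iff₀ hΨP (hΨ.pos hzpos), mul_assoc]
        exact mul_le_mul_of_nonneg_left hΨz hC₂.le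

end TwoWeight
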